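/- Let q : R^n → (−∞,∞] be proper lower semicontinuous convex, F : R^n → R^n continuously differentiable and Lipschitz with modulus ℓ ≥ 0 on a ball B_r(x̄), where x̄ solves 0 ∈ F(x̄) + ∂q(x̄), and let 0 < γ̲ ≤ γ̄. Assume: (i) for every γ ∈ [γ̲, γ̄] and every ε > 0 there exists δ_q > 0 such that hypothesis (H1) holds (SCD semismoothness* of ∂q at (x̄, −F(x̄))); and (ii) there exist κ > 0 and ρ > 0 such that for every γ ∈ [γ̲, γ̄], every x with ‖(x − x̄, x + u_γ(x) − x̄)‖ ≤ ρ, and every B ∈ ∂_B P_{γ⁻¹q}(x − γ⁻¹F(x)), the matrix M̃ := F'(x)ᵀB + γ(I − B) is invertible and the 2n×2n matrix [[BM̃⁻¹, BM̃⁻¹], [γ(I − B)M̃⁻¹, γ(I − B)M̃⁻¹ − I]] has operator norm at most κ. Then there exists a neighborhood U of x̄ such that for every x⁰ ∈ U, any sequence (x^k) generated by x^{k+1} = x^k + Δx^k, where γ^k ∈ [γ̲, γ̄], B^k ∈ ∂_B P_{(γ^k)⁻¹q}(x^k − (γ^k)⁻¹F(x^k)) and (B^k(I − (γ^k)⁻¹F'(x^k))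 − I)Δx^k = −u_{γ^k}(x^k), converges superlinearly to x̄. -/

import Mathlib

open Filter Metric ContinuousLinearMap Asymptotics
open scoped Topology RealInnerProductSpace

noncomputable section

abbrev Eu (n : ℕ) : Type := EuclideanSpace ℝ (Fin n)

/-- `q` is a proper lower semicontinuous convex function with values in `(-∞, ∞]`. -/
def ProperLscConvex {n : ℕ} (q : Eu n → EReal) : Prop :=
  (∀ x, q x ≠ ⊥) ∧ (∃ x, q x ≠ ⊤) ∧ LowerSemicontinuous q ∧
  (∀ x y : Eu n, ∀ a b : ℝ, 0 ≤ a → 0 ≤ b → a + b = 1 →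
    q (a • x + b • y) ≤ (a : EReal) * q x + (b : EReal) * q y)

/-- `P` is the proximal mapping `P_{γ⁻¹ q}`: `P x` is the unique minimizer of
`z ↦ q(z) + (γ/2)‖z − x‖²`. -/
def IsProxOf {n : ℕ} (q : Eu n → EReal) (γ : ℝ) (P : Eu n → Eu n) : Prop :=
  ∀ x z : Eu n,
    (q (P x) + ((γ / 2 * ‖P x - x‖^2 : ℝ) : EReal) ≤ q z + ((γ / 2 * ‖z - x‖^2 : ℝ) : EReal)) ∧
    (q z + ((γ / 2 * ‖z - x‖^2 : ℝ) : EReal) ≤ q (P x) + ((γ / 2 * ‖P x - x‖^2 : ℝ) : EReal)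
      → z = P x)

/-- The convex subdifferential `∂q(y)`. -/
def subdiff {n : ℕ} (q : Eu n → EReal) (y : Eu n) : Set (Eu n) :=
  {v | ∀ z : Eu n, q y + ((⟪v, z - y⟫ : ℝ) : EReal) ≤ q z}

/-- Bouligand subdifferential: all limits of derivatives along sequences of
differentiability points converging to `x`. -/
def BSubdiff {n m : ℕ} (Φ : Eu n → Eu m) (x : Eu n) : Set (Eu n →L[ℝ] Eu m) :=
  {V | ∃ (u : ℕ → Eu n) (Vk : ℕ → Eu n →L[ℝ] Eu m),
      (∀ k, HasFDerivAt Φ (Vk k) (u k)) ∧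
      Tendsto u atTop (𝓝 x) ∧ Tendsto Vk atTop (𝓝 V)}


set_option maxHeartbeats 1000000

lemma ne_top_of_subdiff {n : ℕ} {q : Eu n → EReal} (hq : ProperLscConvex q) {y v : Eu n}
    (h : v ∈ subdiff q y) : q y ≠ ⊤ := by
  obtain ⟨z, hz⟩ := hq.2.1
  intro ht
  have := h z
  rw [ht, EReal.top_add_coe] at this
  exact hz (top_le_iff.1 this)

lemma prox_ne_top {n : ℕ} {q : Eu n → EReal} (hq : ProperLscConvex q) {γ : ℝ} {P : Eu n → Eu n}
    (hP : IsProxOf q γ P) (x : Eu n) : q (P x) ≠ ⊤ := by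
  obtain ⟨z, hz⟩ := hq.2.1
  intro ht
  have := (hP x z).1
  rw [ht, EReal.top_add_coe, top_le_iff] at this
  lift q z to ℝ using ⟨hz, hq.1 z⟩ with a
  rw [← EReal.coe_add] at this
  exact EReal.coe_ne_top _ this

lemma subdiff_real {n : ℕ} {q : Eu n → EReal} (hq : ProperLscConvex q) {y v z : Eu n}
    (h : v ∈ subdiff q y) (hz : q z ≠ ⊤) :
    (q y).toReal + ⟪v, z - y⟫ ≤ (q z).toReal := by
  have h1 := h z
  have hy := ne_top_of_subdiff hq h
  rw [← EReal.coe_toReal hy (hq.1 y), ← EReal.coe_toReal hz (hq.1 z), ← EReal.coe_add] at h1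
  exact_mod_cast h1

lemma prox_real {n : ℕ} {q : Eu n → EReal} (hq : ProperLscConvex q) {γ : ℝ} {P : Eu n → Eu n}
    (hP : IsProxOf q γ P) (x : Eu n) {z : Eu n} (hz : q z ≠ ⊤) :
    (q (P x)).toReal + γ / 2 * ‖P x - x‖^2 ≤ (q z).toReal + γ / 2 * ‖z - x‖^2 := by
  have h1 := (hP x z).1
  rw [← EReal.coe_toReal (prox_ne_top hq hP x) (hq.1 _), ← EReal.coe_toReal hz (hq.1 z),
    ← EReal.coe_add, ← EReal.coe_add] at h1
  exact_mod_cast h1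

lemma prox_of_subdiff {n : ℕ} {q : Eu n → EReal} (hq : ProperLscConvex q) {γ : ℝ} (hγ : 0 < γ)
    {P : Eu n → Eu n} (hP : IsProxOf q γ P) {y v : Eu n} (h : v ∈ subdiff q y) :
    P (y + γ⁻¹ • v) = y := by
  symm
  set x := y + γ⁻¹ • v with hx
  apply (hP x y).2
  have hv : v = γ • (x - y) := by
    rw [hx, add_sub_cancel_left, smul_smul, mul_inv_cancel₀ hγ.ne', one_smul]
  have h1 := subdiff_real hq h (prox_ne_top hq hP x)
  have hy := ne_top_of_subdiff hq h
  rw [← EReal.coe_toReal (prox_ne_top hq hP x) (hq.1 _), ← EReal.coe_toReal hy (hq.1 y),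
    ← EReal.coe_add, ← EReal.coe_add, EReal.coe_le_coe_iff]
  rw [hv, real_inner_smul_left] at h1
  have e : ‖P x - x‖^2 = ‖P x - y‖^2 - 2 * ⟪x - y, P x - y⟫ + ‖y - x‖^2 := by
    have : P x - x = (P x - y) - (x - y) := by abel
    rw [this, norm_sub_sq_real, real_inner_comm, norm_sub_rev y x]
  rw [e]
  nlinarith [mul_nonneg hγ.le (sq_nonneg ‖P x - y‖)]

lemma subdiff_prox {n : ℕ} {q : Eu n → EReal} (hq : ProperLscConvex q) {γ : ℝ} (hγ : 0 < γ)
    {P : Eu n → Eu n} (hP : IsProxOf q γ P) (x : Eu n) :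
    γ • (x - P x) ∈ subdiff q (P x) := by
  intro z
  by_cases hz : q z = ⊤
  · rw [hz]; exact le_top
  set p := P x with hp
  have hpt : q p ≠ ⊤ := prox_ne_top hq hP x
  rw [← EReal.coe_toReal hpt (hq.1 _), ← EReal.coe_toReal hz (hq.1 z),
    ← EReal.coe_add, EReal.coe_le_coe_iff]
  set a := (q p).toReal with ha
  set b := (q z).toReal with hb
  rw [real_inner_smul_left]
  have key : ∀ t : ℝ, 0 < t → t ≤ 1 →
      a - b + γ * ⟪x - p, z - p⟫ ≤ t * (γ / 2 * ‖z - p‖^2) := by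
    intro t ht ht1
    have hc := hq.2.2.2 p z (1 - t) t (by linarith) ht.le (by ring)
    rw [← EReal.coe_toReal hpt (hq.1 _), ← EReal.coe_toReal hz (hq.1 z), ← EReal.coe_mul,
      ← EReal.coe_mul, ← EReal.coe_add] at hc
    have hwt : q ((1 - t) • p + t • z) ≠ ⊤ := fun h => by
      rw [h, top_le_iff] at hc; exact EReal.coe_ne_top _ hc
    have h1 := prox_real hq hP x hwt
    rw [← EReal.coe_toReal hwt (hq.1 _), EReal.coe_le_coe_iff] at hc
    have e : ‖(1 - t) • p + t • z - x‖^2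
        = ‖p - x‖^2 - 2 * t * ⟪x - p, z - p⟫ + t^2 * ‖z - p‖^2 := by
      have : (1 - t) • p + t • z - x = (p - x) + t • (z - p) := by module
      rw [this, norm_add_sq_real, norm_smul, real_inner_smul_right, mul_pow, Real.norm_eq_abs,
        sq_abs, ← neg_sub x p, inner_neg_left, norm_neg]; ring
    rw [e] at h1
    have : t * (a - b + γ * ⟪x - p, z - p⟫) ≤ t * (t * (γ / 2 * ‖z - p‖^2)) := by
      linarith
    exact le_of_mul_le_mul_left this ht
  by_contra hcon
  push Not at hcon
  set s := a - b + γ * ⟪x - p, z - p⟫ with hs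
  have hspos : 0 < s := by linarith
  set c := γ / 2 * ‖z - p‖^2 with hcdef
  have hc0 : 0 ≤ c := by positivity
  have h2 := key (min 1 (s / (2 * (c + 1)))) (by positivity) (min_le_left _ _)
  have h3 : min 1 (s / (2 * (c + 1))) * c ≤ s / (2 * (c + 1)) * c :=
    mul_le_mul_of_nonneg_right (min_le_right _ _) hc0
  have h4 : s / (2 * (c + 1)) * c < s := by
    rw [div_mul_eq_mul_div, div_lt_iff₀ (by positivity)]
    nlinarith [mul_nonneg hspos.le hc0]
  linarith

lemma prox_firm {n : ℕ} {q : Eu n → EReal} (hq : ProperLscConvex q) {γ : ℝ} (hγ : 0 < γ)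
    {P : Eu n → Eu n} (hP : IsProxOf q γ P) (x y : Eu n) :
    ‖P x - P y‖^2 ≤ ⟪P x - P y, x - y⟫ := by
  have h1 := subdiff_real hq (subdiff_prox hq hγ hP x) (prox_ne_top hq hP y)
  have h2 := subdiff_real hq (subdiff_prox hq hγ hP y) (prox_ne_top hq hP x)
  rw [real_inner_smul_left] at h1 h2
  have h3 : γ * (⟪x - P x, P y - P x⟫ + ⟪y - P y, P x - P y⟫) ≤ 0 := by linarith
  have h4 : ⟪x - P x, P y - P x⟫ + ⟪y - P y, P x - P y⟫ ≤ 0 := by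
    by_contra h; push Not at h
    have := mul_pos hγ h
    linarith
  have e : ⟪x - P x, P y - P x⟫ + ⟪y - P y, P x - P y⟫
      = ‖P x - P y‖^2 - ⟪P x - P y, x - y⟫ := by
    rw [← real_inner_self_eq_norm_sq]
    simp only [inner_sub_left, inner_sub_right]
    rw [real_inner_comm (P x) x, real_inner_comm (P y) x, real_inner_comm (P x) y,
      real_inner_comm (P y) y]
    ring
  linarith

lemma prox_nonexp {n : ℕ} {q : Eu n → EReal} (hq : ProperLscConvex q) {γ : ℝ} (hγ : 0 < γ)
    {P : Eu n → Eu n} (hP : IsProxOf q γ P) (x y : Eu n) :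
    ‖P x - P y‖ ≤ ‖x - y‖ := by
  have h1 := prox_firm hq hγ hP x y
  have h2 := real_inner_le_norm (P x - P y) (x - y)
  by_contra h
  push Not at h
  nlinarith [norm_nonneg (x - y), norm_nonneg (P x - P y)]

lemma prox_cont {n : ℕ} {q : Eu n → EReal} (hq : ProperLscConvex q) {γ : ℝ} (hγ : 0 < γ)
    {P : Eu n → Eu n} (hP : IsProxOf q γ P) : Continuous P := by
  apply LipschitzWith.continuous (K := 1)
  apply LipschitzWith.of_dist_le_mul
  intro x y
  simpa [dist_eq_norm] using prox_nonexp hq hγ hP x y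

lemma deriv_firm {n : ℕ} {q : Eu n → EReal} (hq : ProperLscConvex q) {γ : ℝ} (hγ : 0 < γ)
    {P : Eu n → Eu n} (hP : IsProxOf q γ P) {x : Eu n} {B : Eu n →L[ℝ] Eu n}
    (hB : HasFDerivAt P B x) (v : Eu n) : ‖B v‖^2 ≤ ⟪B v, v⟫ := by
  have h := hB.hasLineDerivAt v
  have ht := h.tendsto_slope_zero
  have l1 := (ht.norm).pow 2
  have l2 := ht.inner (𝕜 := ℝ) (tendsto_const_nhds (x := v))
  refine le_of_tendsto_of_tendsto l1 l2 ?_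
  filter_upwards [self_mem_nhdsWithin] with t ht0
  have ht0 : t ≠ 0 := ht0
  have h1 := prox_firm hq hγ hP (x + t • v) x
  rw [add_sub_cancel_left, real_inner_smul_right] at h1
  rw [norm_smul, mul_pow, real_inner_smul_left, norm_inv, Real.norm_eq_abs, inv_pow, sq_abs]
  have : (t^2)⁻¹ * ‖P (x + t • v) - P x‖^2 ≤ (t^2)⁻¹ * (t * ⟪P (x + t • v) - P x, v⟫) := by
    gcongr
  refine this.trans (le_of_eq ?_)
  field_simp

lemma deriv_symm {n : ℕ} {q : Eu n → EReal} (hq : ProperLscConvex q) {γ : ℝ} (hγ : 0 < γ)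
    {P : Eu n → Eu n} (hP : IsProxOf q γ P) {x : Eu n} {B : Eu n →L[ℝ] Eu n}
    (hB : HasFDerivAt P B x) (v w : Eu n) : ⟪B v, w⟫ = ⟪B w, v⟫ := by
  set f : Eu n → ℝ := fun z => ⟪P z, z⟫ - 1 / 2 * ‖P z‖^2 - γ⁻¹ * (q (P z)).toReal with hf
  have key : ∀ y z : Eu n, f y + ⟪P y, z - y⟫ ≤ f z := by
    intro y z
    have h := subdiff_real hq (subdiff_prox hq hγ hP z) (prox_ne_top hq hP y)
    rw [real_inner_smul_left] at h
    have h2 : γ⁻¹ * ((q (P z)).toReal + γ * ⟪z - P z, P y - P z⟫) ≤ γ⁻¹ * (q (P y)).toReal := by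
      gcongr
    rw [mul_add, ← mul_assoc, inv_mul_cancel₀ hγ.ne', one_mul] at h2
    have h3 := sq_nonneg ‖P y - P z‖
    rw [norm_sub_sq_real] at h3
    simp only [hf]
    simp only [inner_sub_left, inner_sub_right, real_inner_self_eq_norm_sq] at h2 ⊢
    rw [real_inner_comm (P y) z, real_inner_comm (P z) z, real_inner_comm (P y) (P z)] at h2
    nlinarith
  have hder : ∀ y, HasFDerivAt f (innerSL ℝ (P y)) y := by
    intro y
    rw [hasFDerivAt_iff_isLittleO]
    rw [Asymptotics.isLittleO_iff]
    intro c hc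
    filter_upwards [Metric.ball_mem_nhds y hc] with z hz
    rw [mem_ball, dist_eq_norm] at hz
    have k1 := key y z
    have k2 := key z y
    have k3 := real_inner_le_norm (P z - P y) (z - y)
    have k4 := prox_nonexp hq hγ hP z y
    have k5 : ⟪P z - P y, z - y⟫ = ⟪P z, z - y⟫ - ⟪P y, z - y⟫ := inner_sub_left _ _ _
    have k6 : ⟪P z, y - z⟫ = - ⟪P z, z - y⟫ := by rw [← neg_sub z y, inner_neg_right]
    rw [innerSL_apply_apply, Real.norm_eq_abs, abs_of_nonneg (by linarith)]
    nlinarith [norm_nonneg (z - y), norm_nonneg (P z - P y)]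
  have h2 : HasFDerivAt (fun y => innerSL ℝ (P y)) ((innerSL ℝ (E := Eu n)).comp B) x :=
    (innerSL ℝ (E := Eu n)).hasFDerivAt.comp x hB
  have := second_derivative_symmetric hder h2 v w
  simpa using this

lemma bsub_firm {n : ℕ} {q : Eu n → EReal} (hq : ProperLscConvex q) {γ : ℝ} (hγ : 0 < γ)
    {P : Eu n → Eu n} (hP : IsProxOf q γ P) {x : Eu n} {B : Eu n →L[ℝ] Eu n}
    (hB : B ∈ BSubdiff P x) (v : Eu n) : ‖B v‖^2 ≤ ⟪B v, v⟫ := by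
  obtain ⟨u, V, hV, -, hVB⟩ := hB
  have h1 : Tendsto (fun k => V k v) atTop (𝓝 (B v)) :=
    ((ContinuousLinearMap.apply ℝ (Eu n) v).continuous.tendsto B).comp hVB
  exact le_of_tendsto_of_tendsto' (h1.norm.pow 2) (h1.inner tendsto_const_nhds)
    (fun k => deriv_firm hq hγ hP (hV k) v)

lemma bsub_symm {n : ℕ} {q : Eu n → EReal} (hq : ProperLscConvex q) {γ : ℝ} (hγ : 0 < γ)
    {P : Eu n → Eu n} (hP : IsProxOf q γ P) {x : Eu n} {B : Eu n →L[ℝ] Eu n}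
    (hB : B ∈ BSubdiff P x) (v w : Eu n) : ⟪B v, w⟫ = ⟪B w, v⟫ := by
  obtain ⟨u, V, hV, -, hVB⟩ := hB
  have h1 : ∀ v, Tendsto (fun k => V k v) atTop (𝓝 (B v)) := fun v =>
    ((ContinuousLinearMap.apply ℝ (Eu n) v).continuous.tendsto B).comp hVB
  have h2 := (h1 v).inner (𝕜 := ℝ) (tendsto_const_nhds (x := w))
  have h3 := (h1 w).inner (𝕜 := ℝ) (tendsto_const_nhds (x := v))
  refine tendsto_nhds_unique h2 (h3.congr fun k => ?_)
  exact deriv_symm hq hγ hP (hV k) w v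

lemma unit_of_firm {n : ℕ} {B : Eu n →L[ℝ] Eu n} (hB : ∀ v, ‖B v‖^2 ≤ ⟪B v, v⟫)
    {c : ℝ} (hc : 0 < c) : IsUnit (B + c • (1 - B)) := by
  rw [ContinuousLinearMap.isUnit_iff_bijective]
  have hinj : Function.Injective (B + c • (1 - B) : Eu n →L[ℝ] Eu n) := by
    rw [injective_iff_map_eq_zero]
    intro v hv
    have h1 : ⟪B v + c • (v - B v), v⟫ = 0 := by
      have : B v + c • (v - B v) = 0 := by simpa using hv
      rw [this, inner_zero_left]
    rw [inner_add_left, real_inner_smul_left, inner_sub_left, real_inner_self_eq_norm_sq] at h1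
    have h2 := hB v
    have h3 := real_inner_le_norm (B v) v
    have h4 : ‖B v‖ ≤ ‖v‖ := by
      by_contra h; push Not at h
      nlinarith [norm_nonneg v, norm_nonneg (B v)]
    have h5 : ⟪B v, v⟫ ≤ ‖v‖^2 := by nlinarith [norm_nonneg v]
    have h6 : 0 ≤ ⟪B v, v⟫ := le_trans (sq_nonneg _) h2
    have h7 : 0 ≤ c * (‖v‖^2 - ⟪B v, v⟫) := mul_nonneg hc.le (by linarith)
    have h8 : ⟪B v, v⟫ = 0 := by linarith
    rw [h8] at h1
    have h9 : ‖v‖^2 = 0 := by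
      have : c * (‖v‖^2 - 0) = 0 := by linarith
      rcases mul_eq_zero.1 this with h | h <;> linarith
    exact norm_eq_zero.1 (pow_eq_zero_iff two_ne_zero |>.1 h9)
  exact ⟨hinj, LinearMap.injective_iff_surjective
    (f := ((B + c • (1 - B) : Eu n →L[ℝ] Eu n) : Eu n →ₗ[ℝ] Eu n)).1 hinj⟩

lemma bsub_change {n : ℕ} {q : Eu n → EReal} (hq : ProperLscConvex q) {γ μ : ℝ} (hγ : 0 < γ)
    (hμ : 0 < μ) {P Q : Eu n → Eu n} (hP : IsProxOf q γ P) (hQ : IsProxOf q μ Q)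
    {x : Eu n} {B : Eu n →L[ℝ] Eu n} (hB : B ∈ BSubdiff P x) (v : Eu n) :
    ∃ C ∈ BSubdiff Q (P x + (γ / μ) • (x - P x)), ∃ w, C w = B v ∧
      μ • (w - C w) = γ • (v - B v) := by
  have hc : 0 < γ / μ := div_pos hγ hμ
  have hBf := bsub_firm hq hγ hP hB
  obtain ⟨u, V, hV, hu, hVB⟩ := hB
  have hUB := unit_of_firm hBf hc
  set f : Eu n → Eu n := fun z => P z + (γ / μ) • (z - P z) with hf
  set g : Eu n → Eu n := fun z => Q z + (μ / γ) • (z - Q z) with hg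
  have hPg : ∀ z, P (g z) = Q z := by
    intro z
    have := prox_of_subdiff hq hγ hP (subdiff_prox hq hμ hQ z)
    rwa [smul_smul, inv_mul_eq_div] at this
  have hQf : ∀ z, Q (f z) = P z := by
    intro z
    have := prox_of_subdiff hq hμ hQ (subdiff_prox hq hγ hP z)
    rwa [smul_smul, inv_mul_eq_div] at this
  have hfg : ∀ z, f (g z) = z := by
    intro z
    have : f (g z) = P (g z) + (γ / μ) • (g z - P (g z)) := rfl
    rw [this, hPg]
    simp only [hg]
    rw [add_sub_cancel_left, smul_smul, div_mul_div_cancel₀ hμ.ne', div_self hγ.ne', one_smul,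
      add_sub_cancel]
  have hgf : ∀ z, g (f z) = z := by
    intro z
    have : g (f z) = Q (f z) + (μ / γ) • (f z - Q (f z)) := rfl
    rw [this, hQf]
    simp only [hf]
    rw [add_sub_cancel_left, smul_smul, div_mul_div_cancel₀ hγ.ne', div_self hμ.ne', one_smul,
      add_sub_cancel]
  have hPc := prox_cont hq hγ hP
  have hQc := prox_cont hq hμ hQ
  have hfc : Continuous f := by fun_prop
  have hgc : Continuous g := by fun_prop
  refine ⟨B * Ring.inverse (B + (γ / μ) • (1 - B)), ⟨fun k => f (u k),
    fun k => V k * Ring.inverse (V k + (γ / μ) • (1 - V k)), ?_, ?_, ?_⟩,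
    (B + (γ / μ) • (1 - B)) v, ?_⟩
  · intro k
    have hVu := unit_of_firm (deriv_firm hq hγ hP (hV k)) hc
    have hfd : HasFDerivAt f (V k + (γ / μ) • (1 - V k)) (g (f (u k))) := by
      rw [hgf]
      exact (hV k).add (((hasFDerivAt_id (u k)).sub (hV k)).const_smul (γ / μ))
    obtain ⟨T, hT⟩ := hVu
    have hgd : HasFDerivAt g (Ring.inverse (V k + (γ / μ) • (1 - V k))) (f (u k)) := by
      rw [← hT] at hfd ⊢
      rw [Ring.inverse_unit]
      exact HasFDerivAt.of_local_left_inverse (f' := ContinuousLinearEquiv.ofUnit T)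
        hgc.continuousAt hfd (Eventually.of_forall hfg)
    have hQ' : Q = P ∘ g := by funext z; exact (hPg z).symm
    rw [hQ']
    have hVk : HasFDerivAt P (V k) (g (f (u k))) := by rw [hgf]; exact hV k
    exact hVk.comp (f (u k)) hgd
  · exact (hfc.tendsto x).comp hu
  · obtain ⟨T, hT⟩ := hUB
    have h1 : Tendsto (fun k => V k + (γ / μ) • (1 - V k)) atTop (𝓝 (B + (γ / μ) • (1 - B))) :=
      hVB.add ((tendsto_const_nhds.sub hVB).const_smul _)
    have h2 := NormedRing.inverse_continuousAt T
    rw [hT] at h2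
    exact hVB.mul (h2.tendsto.comp h1)
  · have h1 : (B * Ring.inverse (B + (γ / μ) • (1 - B))) ((B + (γ / μ) • (1 - B)) v) = B v := by
      have : (B * Ring.inverse (B + (γ / μ) • (1 - B))) * (B + (γ / μ) • (1 - B)) = B := by
        rw [Ring.inverse_mul_cancel_right _ _ hUB]
      exact congrArg (fun L : Eu n →L[ℝ] Eu n => L v) this
    refine ⟨h1, ?_⟩
    rw [h1]
    simp only [add_apply, smul_apply, sub_apply, one_apply_eq_self]
    rw [add_sub_cancel_left, smul_smul, mul_div_cancel₀ _ hμ.ne']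

/-- Proposition 5.10: under SCD semismoothness* of `∂q` at `(x̄, −F(x̄))`
(hypothesis (H1) for all `γ ∈ [γlo, γhi]` and all `ε > 0`) and the uniform
regularity/boundedness condition (ii), the G-semismooth Newton method for the proximal
residual equation `u_γ(x) = 0` converges locally superlinearly to `x̄`, for any choice of
parameters `γ^k ∈ [γlo, γhi]`. -/
theorem stmt14 {n : ℕ} (q : Eu n → EReal) (hq : ProperLscConvex q)
    (P : ℝ → Eu n → Eu n) (hP : ∀ γ > (0:ℝ), IsProxOf q γ (P γ))
    (F : Eu n → Eu n) (hF : ContDiff ℝ 1 F)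
    (xbar : Eu n) (hsol : -F xbar ∈ subdiff q xbar)
    (r ℓ : ℝ) (hr : 0 < r) (hℓ : 0 ≤ ℓ)
    (hLip : ∀ x ∈ Metric.closedBall xbar r, ∀ y ∈ Metric.closedBall xbar r,
      ‖F x - F y‖ ≤ ℓ * ‖x - y‖)
    (γlo γhi : ℝ) (hγlo : 0 < γlo) (hγ : γlo ≤ γhi)
    (hH1 : ∀ γ ∈ Set.Icc γlo γhi, ∀ ε > (0:ℝ), ∃ δq > (0:ℝ),
      ∀ d dstar : Eu n, dstar ∈ subdiff q d →
        Real.sqrt (‖d - xbar‖^2 + ‖dstar + F xbar‖^2) ≤ δq →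
        ∀ B ∈ BSubdiff (P γ) (d + γ⁻¹ • dstar), ∀ v : Eu n,
          |⟪γ • (v - B v), d - xbar⟫ - ⟪B v, dstar + F xbar⟫| ≤
            ε / (2 * Real.sqrt 2 * (ℓ + 1)) *
              Real.sqrt (‖B v‖^2 + ‖γ • (v - B v)‖^2) *
              Real.sqrt (‖d - xbar‖^2 + ‖dstar + F xbar‖^2))
    (hreg : ∃ κ > (0:ℝ), ∃ ρ > (0:ℝ), ∀ γ ∈ Set.Icc γlo γhi, ∀ x : Eu n,
      Real.sqrt (‖x - xbar‖^2 + ‖x + (P γ (x - γ⁻¹ • F x) - x) - xbar‖^2) ≤ ρ →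
      ∀ B ∈ BSubdiff (P γ) (x - γ⁻¹ • F x),
        IsUnit (adjoint (fderiv ℝ F x) * B + γ • (1 - B)) ∧
        (∀ a b : Eu n,
          Real.sqrt
            (‖B ((Ring.inverse (adjoint (fderiv ℝ F x) * B + γ • (1 - B))) a) +
                B ((Ring.inverse (adjoint (fderiv ℝ F x) * B + γ • (1 - B))) b)‖^2 +
              ‖γ • (((1 - B : Eu n →L[ℝ] Eu n))
                  ((Ring.inverse (adjoint (fderiv ℝ F x) * B + γ • (1 - B))) a)) +
                (γ • (((1 - B : Eu n →L[ℝ] Eu n))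
                  ((Ring.inverse (adjoint (fderiv ℝ F x) * B + γ • (1 - B))) b)) - b)‖^2)
          ≤ κ * Real.sqrt (‖a‖^2 + ‖b‖^2))) :
    ∃ U ∈ 𝓝 xbar, ∀ x0 ∈ U, ∀ x : ℕ → Eu n, ∀ γk : ℕ → ℝ,
      x 0 = x0 → (∀ k, γk k ∈ Set.Icc γlo γhi) →
      (∀ k, ∃ B ∈ BSubdiff (P (γk k)) (x k - (γk k)⁻¹ • F (x k)),
        ((B * (1 - (γk k)⁻¹ • fderiv ℝ F (x k)) - 1 : Eu n →L[ℝ] Eu n)) (x (k+1) - x k)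
          = -(P (γk k) (x k - (γk k)⁻¹ • F (x k)) - x k)) →
      Tendsto x atTop (𝓝 xbar) ∧
        (fun k => ‖x (k+1) - xbar‖) =o[atTop] (fun k => ‖x k - xbar‖) := by
  have hsqrt : ∀ a b : ℝ, 0 ≤ a → 0 ≤ b → Real.sqrt (a^2 + b^2) ≤ a + b := by
    intro a b ha hb
    rw [Real.sqrt_le_left (by positivity)]
    nlinarith [mul_nonneg ha hb]
  obtain ⟨κ, hκ, ρ, hρ, hreg⟩ := hreg
  have step : ∀ ε > (0:ℝ), ∃ δ > (0:ℝ), ∀ γ ∈ Set.Icc γlo γhi, ∀ x y : Eu n,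
      ‖x - xbar‖ ≤ δ → (∃ B ∈ BSubdiff (P γ) (x - γ⁻¹ • F x),
        ((B * (1 - γ⁻¹ • fderiv ℝ F x) - 1 : Eu n →L[ℝ] Eu n)) (y - x)
          = -(P γ (x - γ⁻¹ • F x) - x)) → ‖y - xbar‖ ≤ ε * ‖x - xbar‖ := by
    intro ε hε
    set C1 : ℝ := 1 + ℓ / γlo with hC1
    have hC1p : 1 ≤ C1 := by rw [hC1]; have := div_nonneg hℓ hγlo.le; linarith
    have hγhi : 0 < γhi := hγlo.trans_le hγ
    set C2 : ℝ := γhi * (1 + C1) + ℓ with hC2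
    have hC2p : 0 ≤ C2 := by rw [hC2]; positivity
    set C : ℝ := C1 + C2 with hC
    have hCp : 0 < C := by linarith
    set η : ℝ := ε / (2 * κ) with hη
    have hηp : 0 < η := by positivity
    set s : ℝ := ε / (2 * κ * C) with hs
    have hsp : 0 < s := by positivity
    have hmulp : 0 < 2 * Real.sqrt 2 * (ℓ + 1) := by positivity
    obtain ⟨δq, hδq, hq1⟩ := hH1 γlo ⟨le_refl _, hγ⟩ (s * (2 * Real.sqrt 2 * (ℓ + 1)))
      (mul_pos hsp hmulp)
    rw [mul_div_assoc, div_self hmulp.ne', mul_one] at hq1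
    -- the estimate for F
    have hFe : ∀ᶠ x in 𝓝 xbar,
        ‖fderiv ℝ F x (x - xbar) - (F x - F xbar)‖ ≤ η * ‖x - xbar‖ := by
      have h1 : HasFDerivAt F (fderiv ℝ F xbar) xbar :=
        (hF.differentiable one_ne_zero xbar).hasFDerivAt
      have h2 := (Asymptotics.isLittleO_iff.1 (hasFDerivAt_iff_isLittleO.1 h1)) (half_pos hηp)
      have h3 : ∀ᶠ x in 𝓝 xbar, ‖fderiv ℝ F x - fderiv ℝ F xbar‖ < η / 2 := by
        have := (hF.continuous_fderiv one_ne_zero).tendsto xbar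
        have := Metric.tendsto_nhds.1 this (η / 2) (half_pos hηp)
        simpa [dist_eq_norm] using this
      filter_upwards [h2, h3] with x h2 h3
      have e : fderiv ℝ F x (x - xbar) - (F x - F xbar)
          = (fderiv ℝ F x - fderiv ℝ F xbar) (x - xbar)
            - (F x - F xbar - fderiv ℝ F xbar (x - xbar)) := by
        rw [sub_apply]; abel
      rw [e]
      have h4 := (fderiv ℝ F x - fderiv ℝ F xbar).le_opNorm (x - xbar)
      have h5 : ‖fderiv ℝ F x - fderiv ℝ F xbar‖ * ‖x - xbar‖ ≤ η / 2 * ‖x - xbar‖ := by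
        gcongr
      refine (norm_sub_le _ _).trans ?_
      linarith
    obtain ⟨δF, hδF, hFe⟩ := Metric.eventually_nhds_iff.1 hFe
    refine ⟨min (min r (δF / 2)) (min (ρ / (1 + C1)) (δq / C)), by positivity, ?_⟩
    rintro γ hγI x y hx ⟨B, hB, hN⟩
    have hγp : 0 < γ := hγlo.trans_le hγI.1
    have hxr : ‖x - xbar‖ ≤ r := hx.trans ((min_le_left _ _).trans (min_le_left _ _))
    have hxF : ‖x - xbar‖ ≤ δF / 2 := hx.trans ((min_le_left _ _).trans (min_le_right _ _))
    have hxρ : (1 + C1) * ‖x - xbar‖ ≤ ρ := by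
      have := hx.trans ((min_le_right _ _).trans (min_le_left _ _))
      rw [le_div_iff₀ (by linarith)] at this; linarith
    have hxq : C * ‖x - xbar‖ ≤ δq := by
      have := hx.trans ((min_le_right _ _).trans (min_le_right _ _))
      rw [le_div_iff₀ hCp] at this; linarith
    have hFx := hFe (y := x) (by rw [dist_eq_norm]; linarith)
    have hLx : ‖F x - F xbar‖ ≤ ℓ * ‖x - xbar‖ :=
      hLip x (by rwa [mem_closedBall, dist_eq_norm]) xbar (mem_closedBall_self hr.le)
    set e := ‖x - xbar‖ with he
    have he0 : 0 ≤ e := norm_nonneg _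
    set d := P γ (x - γ⁻¹ • F x) with hd
    have hPγ := hP γ hγp
    have hxb : P γ (xbar - γ⁻¹ • F xbar) = xbar := by
      have := prox_of_subdiff hq hγp hPγ hsol
      rwa [smul_neg, ← sub_eq_add_neg] at this
    have hdx : ‖d - xbar‖ ≤ C1 * e := by
      have h1 := prox_nonexp hq hγp hPγ (x - γ⁻¹ • F x) (xbar - γ⁻¹ • F xbar)
      rw [hxb] at h1
      have h2 : x - γ⁻¹ • F x - (xbar - γ⁻¹ • F xbar) = (x - xbar) - γ⁻¹ • (F x - F xbar) := by
        module
      rw [h2] at h1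
      have h3 : ‖γ⁻¹ • (F x - F xbar)‖ ≤ γlo⁻¹ * (ℓ * e) := by
        rw [norm_smul, Real.norm_eq_abs, abs_of_pos (inv_pos.2 hγp)]
        have := hγI.1
        gcongr
      have h4 := norm_sub_le (x - xbar) (γ⁻¹ • (F x - F xbar))
      have h5 : C1 * e = e + γlo⁻¹ * (ℓ * e) := by rw [hC1]; ring
      linarith
    set ds := γ • (x - γ⁻¹ • F x - d) with hds
    have hdsub : ds ∈ subdiff q d := subdiff_prox hq hγp hPγ (x - γ⁻¹ • F x)
    have hds2 : ds + F xbar = γ • (x - d) - (F x - F xbar) := by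
      rw [hds, smul_sub, smul_sub, smul_smul, mul_inv_cancel₀ hγp.ne', one_smul, smul_sub]; abel
    have hdsn : ‖ds + F xbar‖ ≤ C2 * e := by
      rw [hds2]
      have h1 := norm_sub_le (γ • (x - d)) (F x - F xbar)
      have h2 : ‖x - d‖ ≤ (1 + C1) * e := by
        have : x - d = (x - xbar) - (d - xbar) := by abel
        rw [this]
        have := norm_sub_le (x - xbar) (d - xbar)
        linarith
      have h3 : ‖γ • (x - d)‖ ≤ γhi * ((1 + C1) * e) := by
        rw [norm_smul, Real.norm_eq_abs, abs_of_pos hγp]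
        have := hγI.2
        gcongr
      have h5 : C2 * e = γhi * ((1 + C1) * e) + ℓ * e := by rw [hC2]; ring
      linarith
    have hpair : Real.sqrt (‖d - xbar‖^2 + ‖ds + F xbar‖^2) ≤ C * e := by
      refine (hsqrt _ _ (norm_nonneg _) (norm_nonneg _)).trans ?_
      rw [hC, add_mul]; linarith
    have hr1 := hreg γ hγI x (by
      rw [add_sub_cancel]
      refine (hsqrt _ _ (norm_nonneg _) (norm_nonneg _)).trans ?_
      linarith) B hB
    obtain ⟨hU, hbd⟩ := hr1
    set M := adjoint (fderiv ℝ F x) * B + γ • (1 - B) with hM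
    set z := y - xbar with hz
    set v := Ring.inverse M z with hv
    have hMv : adjoint (fderiv ℝ F x) (B v) + γ • (v - B v) = z := by
      have h1 : M * Ring.inverse M = 1 := Ring.mul_inverse_cancel _ hU
      have h2 := congrArg (fun L : Eu n →L[ℝ] Eu n => L z) h1
      simpa [hM, hv] using h2
    have hvb : Real.sqrt (‖B v‖^2 + ‖γ • (v - B v)‖^2) ≤ κ * ‖z‖ := by
      have h1 := hbd z 0
      simpa [Real.sqrt_sq] using h1
    have hBv : ‖B v‖ ≤ κ * ‖z‖ := by
      refine le_trans (Real.le_sqrt_of_sq_le ?_) hvb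
      nlinarith [sq_nonneg ‖γ • (v - B v)‖]
    -- use of (H1) at the parameter `γlo`
    have hH : |⟪γ • (v - B v), d - xbar⟫ - ⟪B v, ds + F xbar⟫| ≤ s * (κ * ‖z‖) * (C * e) := by
      obtain ⟨B', hB', w, hw1, hw2⟩ := bsub_change hq hγp hγlo hPγ (hP γlo hγlo) hB v
      have hpt : d + γlo⁻¹ • ds = d + (γ / γlo) • (x - γ⁻¹ • F x - d) := by
        rw [hds, smul_smul, inv_mul_eq_div]
      have h1 := hq1 d ds hdsub (hpair.trans hxq) B' (by rw [hpt]; exact hB') w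
      rw [hw2, hw1] at h1
      refine h1.trans ?_
      gcongr
    -- the Newton equation
    have hN2 : B (x - xbar) - γ⁻¹ • B (fderiv ℝ F x (x - xbar)) - (d - xbar)
        = B z - γ⁻¹ • B (fderiv ℝ F x z) - z := by
      have hyx : y - x = z - (x - xbar) := by rw [hz]; abel
      rw [hyx] at hN
      have hN' : B ((z - (x - xbar)) - γ⁻¹ • fderiv ℝ F x (z - (x - xbar))) - (z - (x - xbar))
          = -(d - x) := hN
      rw [map_sub (fderiv ℝ F x) z (x - xbar), map_sub B, map_smul B,
        map_sub B z (x - xbar), map_sub B (fderiv ℝ F x z)] at hN'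
      rw [← sub_eq_zero] at hN' ⊢
      rw [← neg_eq_zero, ← hN']
      module
    have hinner := congrArg (fun t => ⟪t, γ • v⟫) hN2
    have hBs := bsub_symm hq hγp hPγ hB
    have hzz : ‖z‖^2 = (⟪γ • (v - B v), d - xbar⟫ - ⟪B v, ds + F xbar⟫)
        + ⟪B v, fderiv ℝ F x (x - xbar) - (F x - F xbar)⟫ := by
      have hz1 : ‖z‖^2 = ⟪B v, fderiv ℝ F x z⟫ + γ * ⟪v - B v, z⟫ := by
        rw [← real_inner_self_eq_norm_sq]
        nth_rewrite 1 [← hMv]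
        rw [inner_add_left, adjoint_inner_left, real_inner_smul_left]
      rw [hz1, hds2]
      simp only [inner_sub_left, inner_sub_right, real_inner_smul_left,
        real_inner_smul_right, hBs _ v, map_sub] at hinner ⊢
      have c1 : ∀ a : Eu n, ⟪a, v⟫ = ⟪v, a⟫ := fun a => real_inner_comm _ _
      simp only [c1] at hinner
      field_simp at hinner
      linear_combination hinner
    have hfin : ‖z‖^2 ≤ (ε * e) * ‖z‖ := by
      have h1 := le_abs_self (⟪γ • (v - B v), d - xbar⟫ - ⟪B v, ds + F xbar⟫)
      have h2 := real_inner_le_norm (B v) (fderiv ℝ F x (x - xbar) - (F x - F xbar))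
      have h3 : ‖B v‖ * ‖fderiv ℝ F x (x - xbar) - (F x - F xbar)‖ ≤ (κ * ‖z‖) * (η * e) := by
        gcongr
      have h4 : s * (κ * ‖z‖) * (C * e) + (κ * ‖z‖) * (η * e) = (ε * e) * ‖z‖ := by
        rw [hs, hη]; field_simp; ring
      linarith
    by_contra hcon
    push Not at hcon
    have : 0 ≤ ε * e := by positivity
    nlinarith
  obtain ⟨δ, hδ, hstep⟩ := step (1/2) (by norm_num)
  refine ⟨closedBall xbar δ, closedBall_mem_nhds _ hδ, ?_⟩
  intro x0 hx0 x γk hx00 hγk hx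
  have hx0' : ‖x 0 - xbar‖ ≤ δ := by rw [hx00, ← dist_eq_norm]; exact hx0
  have hgeo : ∀ k, ‖x k - xbar‖ ≤ (1/2 : ℝ)^k * δ := by
    intro k
    induction k with
    | zero => simpa using hx0'
    | succ k ih =>
      have h1 : (1/2 : ℝ)^k ≤ 1 := pow_le_one₀ (by norm_num) (by norm_num)
      have h2 : ‖x k - xbar‖ ≤ δ := ih.trans (by nlinarith)
      have h3 := hstep (γk k) (hγk k) (x k) (x (k+1)) h2 (hx k)
      rw [pow_succ]; linarith
  have ht0 : Tendsto (fun k => ‖x k - xbar‖) atTop (𝓝 0) := by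
    refine squeeze_zero (fun _ => norm_nonneg _) hgeo ?_
    have := (tendsto_pow_atTop_nhds_zero_of_lt_one (r := (1/2 : ℝ)) (by norm_num)
      (by norm_num)).mul_const δ
    simpa using this
  refine ⟨tendsto_iff_norm_sub_tendsto_zero.2 ht0, ?_⟩
  rw [Asymptotics.isLittleO_iff]
  intro c hc
  obtain ⟨δ', hδ', hstep'⟩ := step c hc
  filter_upwards [ht0.eventually (Iic_mem_nhds hδ')] with k hk
  rw [norm_norm, norm_norm]
  exact hstep' (γk k) (hγk k) (x k) (x (k+1)) hk (hx k)
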